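/- arXiv:0806.1125 — 2 statements merged into one kernel-verified Lean document; each statement's English description precedes it below -/
import Mathlib

section
/- Let 2 ≤ i ≤ n and let V be a positive word whose letters lie among a_1, …, a_{i−1}. Then in the positive braid monoid B⁺_{n+1} one has a_i Λ_{i−1} V Λ_i = Λ_{i−1} Λ_i a_1 V'. -/
/-- Defining relations of the braid monoid/group on `n` strands' generators `Fin n`
(generator `i : Fin n` represents the Artin generator `a_{i+1}`):
braid relations `a_{i+1} a_i a_{i+1} = a_i a_{i+1} a_i` and
commutation `a_k a_s = a_s a_k` for `k - s ≥ 2`. -/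
def braidRels (n : ℕ) : FreeMonoid (Fin n) → FreeMonoid (Fin n) → Prop := fun x y =>
  (∃ i j : Fin n, (i : ℕ) + 1 = j ∧
      x = .of j * .of i * .of j ∧ y = .of i * .of j * .of i) ∨
  (∃ i j : Fin n, (i : ℕ) + 2 ≤ j ∧
      x = .of j * .of i ∧ y = .of i * .of j)

/-- The positive braid monoid `B⁺_{n+1}`. -/
def BraidMonoid (n : ℕ) : Type := PresentedMonoid (braidRels n)

instance (n : ℕ) : Monoid (BraidMonoid n) :=
  inferInstanceAs (Monoid (PresentedMonoid (braidRels n)))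

/-- Relators of the braid group `B_{n+1}` on generators `Fin n`. -/
def braidRelators (n : ℕ) : Set (FreeGroup (Fin n)) :=
  {r | (∃ i j : Fin n, (i : ℕ) + 1 = j ∧
          r = .of j * .of i * .of j * (.of i * .of j * .of i)⁻¹) ∨
       (∃ i j : Fin n, (i : ℕ) + 2 ≤ j ∧
          r = .of j * .of i * (.of i * .of j)⁻¹)}

/-- The braid group `B_{n+1}`. -/
def BraidGroup (n : ℕ) : Type := PresentedGroup (braidRelators n)

instance (n : ℕ) : Group (BraidGroup n) :=
  inferInstanceAs (Group (PresentedGroup (braidRelators n)))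

namespace Braid

/-- The Artin generator `a_i` (`1 ≤ i ≤ n`) of the positive braid monoid;
junk value `1` outside this range. -/
def a (n i : ℕ) : BraidMonoid n :=
  if h : 1 ≤ i ∧ i ≤ n then PresentedMonoid.of (braidRels n) ⟨i - 1, by omega⟩ else 1

/-- The Artin generator `a_i` (`1 ≤ i ≤ n`) of the braid group; junk value `1` otherwise. -/
def b (n i : ℕ) : BraidGroup n :=
  if h : 1 ≤ i ∧ i ≤ n then PresentedGroup.of (rels := braidRelators n) ⟨i - 1, by omega⟩ else 1

/-- The element of `B⁺_{n+1}` given by a positive word, i.e. a list of indices of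
Artin generators. -/
def w (n : ℕ) (L : List ℕ) : BraidMonoid n := (L.map (a n)).prod

/-- The element of `B_{n+1}` given by a positive word. -/
def wG (n : ℕ) (L : List ℕ) : BraidGroup n := (L.map (b n)).prod

/-- `Λ_i = a_i a_{i-1} ⋯ a_1`. -/
def Lam (n i : ℕ) : BraidMonoid n := ((List.range i).reverse.map (fun m => a n (m + 1))).prod

/-- `Λ_i^{(−)} = a_i a_{i-1} ⋯ a_2`  (`Λ_1^{(−)} = 1`). -/
def LamM (n i : ℕ) : BraidMonoid n :=
  ((List.range (i - 1)).reverse.map (fun m => a n (m + 2))).prod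

/-- `Λ_i^{(−−)} = a_i a_{i-1} ⋯ a_3`  (`Λ_2^{(−−)} = 1`). -/
def LamMM (n i : ℕ) : BraidMonoid n :=
  ((List.range (i - 2)).reverse.map (fun m => a n (m + 3))).prod

/-- `Δ_i = Λ_1 Λ_2 ⋯ Λ_i`. -/
def DeltaI (n i : ℕ) : BraidMonoid n := ((List.range i).map (fun m => Lam n (m + 1))).prod

/-- The Garside element `Δ = Λ_1 Λ_2 ⋯ Λ_n`. -/
def Delta (n : ℕ) : BraidMonoid n := DeltaI n n

/-- `Λ_i` in the braid group. -/
def LamG (n i : ℕ) : BraidGroup n := ((List.range i).reverse.map (fun m => b n (m + 1))).prod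

/-- `Δ_i = Λ_1 Λ_2 ⋯ Λ_i` in the braid group. -/
def DeltaIG (n i : ℕ) : BraidGroup n := ((List.range i).map (fun m => LamG n (m + 1))).prod

/-- The descending run `a_{ij} = a_i a_{i-1} ⋯ a_j` (`j ≤ i`), with `a_{i,i+1} = 1`. -/
def run (n i j : ℕ) : BraidMonoid n :=
  ((List.range (i + 1 - j)).reverse.map (fun m => a n (m + j))).prod

end Braid

namespace Braid

theorem a_braid (n i : ℕ) (h1 : 1 ≤ i) (h2 : i + 1 ≤ n) :
    a n (i + 1) * a n i * a n (i + 1) = a n i * a n (i + 1) * a n i := by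
  have hi : a n i = PresentedMonoid.of (braidRels n) ⟨i - 1, by omega⟩ := dif_pos ⟨h1, by omega⟩
  have hj : a n (i + 1) = PresentedMonoid.of (braidRels n) ⟨i, by omega⟩ :=
    dif_pos ⟨by omega, h2⟩
  rw [hi, hj]
  exact PresentedMonoid.mk_eq_mk_of_rel
    (Or.inl ⟨⟨i - 1, by omega⟩, ⟨i, by omega⟩, Nat.sub_add_cancel h1, rfl, rfl⟩)

theorem commute_a (n k s : ℕ) (h1 : 1 ≤ s) (h2 : s + 2 ≤ k) (h3 : k ≤ n) :
    Commute (a n k) (a n s) := by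
  have hs : a n s = PresentedMonoid.of (braidRels n) ⟨s - 1, by omega⟩ := dif_pos ⟨h1, by omega⟩
  have hk : a n k = PresentedMonoid.of (braidRels n) ⟨k - 1, by omega⟩ :=
    dif_pos ⟨by omega, h3⟩
  rw [hs, hk]
  refine PresentedMonoid.mk_eq_mk_of_rel
    (Or.inr ⟨⟨s - 1, by omega⟩, ⟨k - 1, by omega⟩, ?_, rfl, rfl⟩)
  change s - 1 + 2 ≤ k - 1
  omega

theorem Lam_succ (n i : ℕ) : Lam n (i + 1) = a n (i + 1) * Lam n i := by
  simp [Lam, List.range_succ]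

theorem Lam_eq_w (n i : ℕ) : Lam n i = w n ((List.range i).reverse.map (· + 1)) := by
  simp [Lam, w, Function.comp_def]

theorem Lam_succ_eq_shift_mul (n i : ℕ) :
    Lam n (i + 1) = w n (((List.range i).reverse.map (· + 1)).map (· + 1)) * a n 1 := by
  simp [Lam, w, List.range_succ_eq_map, Function.comp_def]

theorem commute_a_Lam (n k i : ℕ) (h : i + 2 ≤ k) (hk : k ≤ n) :
    Commute (a n k) (Lam n i) := by
  induction i with
  | zero => simp [Lam]
  | succ i ih =>
    rw [Lam_succ]
    exact (commute_a n k (i + 1) (by omega) h hk).mul_right (ih (by omega))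

/-- `Λ_i` shifts the generators `a_1, …, a_{i-1}` up by one. -/
theorem a_mul_Lam (n m i : ℕ) (hm : 1 ≤ m) (hmi : m < i) (hi : i ≤ n) :
    a n m * Lam n i = Lam n i * a n (m + 1) := by
  induction i with
  | zero => omega
  | succ i ih =>
    rcases Nat.lt_succ_iff_lt_or_eq.mp hmi with h | rfl
    · rw [Lam_succ, ← mul_assoc, ← (commute_a n (i + 1) m hm (by omega) hi).eq, mul_assoc,
        ih h (by omega), mul_assoc]
    · obtain ⟨k, rfl⟩ := Nat.exists_eq_add_of_le' hm
      rw [Lam_succ, Lam_succ, ← mul_assoc, ← mul_assoc, ← a_braid n (k + 1) hm hi, mul_assoc,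
        (commute_a_Lam n (k + 1 + 1) k le_rfl hi).eq]
      simp only [mul_assoc]

/-- `V Λ_i = Λ_i V'` for words `V` in `a_1, …, a_{i-1}`. -/
theorem w_mul_Lam (n i : ℕ) (hi : i ≤ n) (V : List ℕ) (hV : ∀ m ∈ V, 1 ≤ m ∧ m < i) :
    w n V * Lam n i = Lam n i * w n (V.map (· + 1)) := by
  induction V with
  | nil => simp [w]
  | cons m V ih =>
    have hm := hV m List.mem_cons_self
    have hw (x : ℕ) (L : List ℕ) : w n (x :: L) = a n x * w n L := by simp [w]
    rw [List.map_cons, hw, hw, mul_assoc, ih fun x hx => hV x (List.mem_cons_of_mem _ hx),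
      ← mul_assoc, a_mul_Lam n m i hm.1 hm.2 hi, mul_assoc]

theorem Lam_mul_Lam_succ_mul_a_one (n i : ℕ) (hi : i + 1 ≤ n) :
    Lam n i * Lam n (i + 1) * a n 1 = Lam n (i + 1) * Lam n (i + 1) := by
  rw [Lam_eq_w n i, w_mul_Lam n (i + 1) hi _ (by simp), mul_assoc, ← Lam_succ_eq_shift_mul]

end Braid

/-- For `2 ≤ i ≤ n` and a positive word `V` in the letters `a_1, …, a_{i−1}`,
in the positive braid monoid `B⁺_{n+1}` one has `a_i Λ_{i−1} V Λ_i = Λ_{i−1} Λ_i a_1 V'`. -/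
theorem a_mul_Lam_mul_word_mul_Lam (n i : ℕ) (hi1 : 2 ≤ i) (hi2 : i ≤ n) (V : List ℕ)
    (hV : ∀ m ∈ V, 1 ≤ m ∧ m ≤ i - 1) :
    Braid.a n i * Braid.Lam n (i - 1) * Braid.w n V * Braid.Lam n i
      = Braid.Lam n (i - 1) * Braid.Lam n i * Braid.a n 1 * Braid.w n (V.map (· + 1)) := by
  obtain ⟨k, rfl⟩ := Nat.exists_eq_add_of_le' (show 1 ≤ i by omega)
  rw [Nat.add_sub_cancel, Braid.Lam_mul_Lam_succ_mul_a_one n k hi2, ← Braid.Lam_succ, mul_assoc,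
    Braid.w_mul_Lam n (k + 1) hi2 V fun m hm => ⟨(hV m hm).1, by have := (hV m hm).2; omega⟩,
    mul_assoc]
end

section
/- Let 2 ≤ i ≤ n, let V be a positive word whose letters lie among a_1, …, a_{i−2}, and let W be a positive word whose letters lie among a_2, …, a_{i−1}. Then in the positive braid monoid B⁺_{n+1} one has a_i V Λ_{i−1} W Λ_i^{(−)} = Λ_{i−1} Λ_i V^{(2)} W'. -/
namespace Braid

theorem a_eq_of {n k : ℕ} (hk : 1 ≤ k) (hkn : k ≤ n) :
    a n k = PresentedMonoid.of (braidRels n) ⟨k - 1, by omega⟩ :=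
  dif_pos ⟨hk, hkn⟩

theorem a_eq_one {n k : ℕ} (h : ¬(1 ≤ k ∧ k ≤ n)) : a n k = 1 :=
  dif_neg h

theorem a_mul_a_comm (n : ℕ) {k m : ℕ} (h : k + 2 ≤ m) : a n m * a n k = a n k * a n m := by
  by_cases hm : 1 ≤ m ∧ m ≤ n
  · by_cases hk : 1 ≤ k ∧ k ≤ n
    · rw [a_eq_of hm.1 hm.2, a_eq_of hk.1 hk.2]
      exact Quotient.sound (ConGen.Rel.of _ _
        (Or.inr ⟨⟨k - 1, by omega⟩, ⟨m - 1, by omega⟩, by simp only; omega, rfl, rfl⟩))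
    · simp [a_eq_one hk]
  · simp [a_eq_one hm]

theorem a_braid_s12 {n k : ℕ} (hk : 1 ≤ k) (hkn : k + 1 ≤ n) :
    a n (k + 1) * a n k * a n (k + 1) = a n k * a n (k + 1) * a n k := by
  rw [a_eq_of (k := k + 1) (by omega) hkn, a_eq_of hk (by omega)]
  exact Quotient.sound (ConGen.Rel.of _ _
    (Or.inl ⟨⟨k - 1, by omega⟩, ⟨k + 1 - 1, by omega⟩, by simp only; omega, rfl, rfl⟩))

theorem run_succ (n : ℕ) {i j : ℕ} (h : j ≤ i + 1) :
    run n (i + 1) j = a n (i + 1) * run n i j := by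
  unfold run
  rw [show i + 1 + 1 - j = (i + 1 - j) + 1 by omega, List.range_succ]
  simp [show i + 1 - j + j = i + 1 by omega]

theorem run_of_lt (n : ℕ) {i j : ℕ} (h : i < j) : run n i j = 1 := by
  simp [run, show i + 1 - j = 0 by omega]

theorem a_mul_run_comm (n : ℕ) {m j i : ℕ} (h : i + 2 ≤ m) :
    a n m * run n i j = run n i j * a n m := by
  induction i with
  | zero =>
    rcases j with _ | j
    · simpa [run] using a_mul_a_comm n h
    · simp [run_of_lt]
  | succ i ih =>
    rcases Nat.lt_or_ge (i + 1) j with hj | hj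
    · simp [run_of_lt n hj]
    · rw [run_succ n hj, ← mul_assoc, a_mul_a_comm n h, mul_assoc, ih (by omega), mul_assoc]

/-- Moving a generator rightwards across a descending run shifts its index by one. -/
theorem a_mul_run {n i j m : ℕ} (hj : 1 ≤ j) (hjm : j ≤ m) (hmi : m < i) (hin : i ≤ n) :
    a n m * run n i j = run n i j * a n (m + 1) := by
  induction i with
  | zero => omega
  | succ i ih =>
    rw [run_succ n (by omega)]
    rcases Nat.lt_or_ge m i with h | h
    · rw [← mul_assoc, ← a_mul_a_comm n (by omega), mul_assoc, ih h (by omega), mul_assoc]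
    · obtain rfl : m = i := by omega
      obtain ⟨k, rfl⟩ : ∃ k, m = k + 1 := ⟨m - 1, by omega⟩
      rw [run_succ n hjm, ← mul_assoc, ← mul_assoc, ← a_braid_s12 (by omega) hin]
      simp only [mul_assoc]
      rw [a_mul_run_comm n (by omega)]

theorem w_cons (n m : ℕ) (L : List ℕ) : w n (m :: L) = a n m * w n L := by simp [w]

theorem w_mul_run {n i j : ℕ} (hj : 1 ≤ j) (hin : i ≤ n) (L : List ℕ)
    (hL : ∀ m ∈ L, j ≤ m ∧ m < i) :
    w n L * run n i j = run n i j * w n (L.map (· + 1)) := by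
  induction L with
  | nil => simp [w]
  | cons m L ih =>
    obtain ⟨hm, hL⟩ := List.forall_mem_cons.1 hL
    rw [List.map_cons, w_cons, w_cons, mul_assoc, ih hL, ← mul_assoc,
      a_mul_run hj hm.1 hm.2 hin, mul_assoc]

theorem Lam_eq_run (n i : ℕ) : Lam n i = run n i 1 := rfl

theorem LamM_eq_run (n i : ℕ) : LamM n i = run n i 2 := rfl

theorem LamM_eq_w (n i : ℕ) : LamM n i = w n ((List.range (i - 1)).reverse.map (· + 2)) := by
  simp [LamM, w, Function.comp_def]

theorem Lam_pred_mul_Lam {n i : ℕ} (hin : i ≤ n) :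
    Lam n (i - 1) * Lam n i = Lam n i * LamM n i := by
  rw [Lam_eq_w n (i - 1), Lam_eq_run n i, w_mul_run le_rfl hin, LamM_eq_w, List.map_map]
  · rfl
  · simp only [List.mem_map, List.mem_reverse, List.mem_range]
    rintro _ ⟨k, hk, rfl⟩
    omega

end Braid

/-- For `2 ≤ i ≤ n`, a positive word `V` in the letters `a_1, …, a_{i−2}`, and a
positive word `W` in the letters `a_2, …, a_{i−1}`, in the positive braid monoid `B⁺_{n+1}`
one has `a_i V Λ_{i−1} W Λ_i^{(−)} = Λ_{i−1} Λ_i V^{(2)} W'`. -/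
theorem a_mul_word_mul_Lam_mul_word_mul_LamM (n i : ℕ) (hi1 : 2 ≤ i) (hi2 : i ≤ n)
    (V : List ℕ) (hV : ∀ m ∈ V, 1 ≤ m ∧ m ≤ i - 2)
    (W : List ℕ) (hW : ∀ m ∈ W, 2 ≤ m ∧ m ≤ i - 1) :
    Braid.a n i * Braid.w n V * Braid.Lam n (i - 1) * Braid.w n W * Braid.LamM n i
      = Braid.Lam n (i - 1) * Braid.Lam n i * Braid.w n (V.map (· + 2))
          * Braid.w n (W.map (· + 1)) := by
  have h : Braid.a n i * Braid.Lam n (i - 1) = Braid.Lam n i := by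
    obtain ⟨k, rfl⟩ : ∃ k, i = k + 1 := ⟨i - 1, by omega⟩
    exact (Braid.run_succ n (by omega)).symm
  have hV₁ := Braid.w_mul_run (n := n) (i := i - 1) le_rfl (by omega) V
    fun m hm => by have := hV m hm; omega
  have hV₂ := Braid.w_mul_run (n := n) (i := i) (j := 2) (by omega) hi2 (V.map (· + 1)) <| by
    simp only [List.mem_map]
    rintro _ ⟨m, hm, rfl⟩
    have := hV m hm
    omega
  have hW₁ := Braid.w_mul_run (n := n) (i := i) (j := 2) (by omega) hi2 W
    fun m hm => by have := hW m hm; omega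
  rw [List.map_map] at hV₂
  rw [← Braid.Lam_eq_run] at hV₁
  rw [← Braid.LamM_eq_run] at hV₂ hW₁
  rw [Braid.Lam_pred_mul_Lam hi2, mul_assoc _ (Braid.w n W), hW₁, mul_assoc _ (Braid.w n V), hV₁,
    ← mul_assoc, ← mul_assoc, h, mul_assoc _ _ (Braid.LamM n i), hV₂, ← mul_assoc]
  rfl
end
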